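/- Let $f\in L_p(\mathbb{T})$, $1\le p<\infty$, $r,n\in\mathbb{N}$, and suppose the sampling operators $G_n$, $n\in\mathbb{N}$, satisfy conditions (c1), (c1'), (c2') for some $s\in\mathbb{N}$ with $s\le 2r$, and condition (c4). Then, with the convention $G_{2^{-1}}(f):=0$, there exists a constant $C>0$ independent of $f$ and $n$ such that $\|f_{\gamma/n,\,r}-f\|_{\ell_p(X_n)}+\omega_s(f,1/n)_p\le C\Big(\|f-G_n(f)\|_p+\frac1{n^s}\sum_{k=0}^{[\log_2 n]}2^{sk}\big(\|f-G_{2^{k}}(f)\|_p+\|f-G_{2^{k-1}}(f)\|_p\big)\Big)$. -/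

import Mathlib

open MeasureTheory Filter Finset

noncomputable def LpNorm (p : ℝ) (f : ℝ → ℝ) : ℝ :=
  (∫ x in (0:ℝ)..1, |f x| ^ p) ^ (1 / p)

def MemLpT (p : ℝ) (f : ℝ → ℝ) : Prop :=
  Function.Periodic f 1 ∧ Measurable f ∧
    IntervalIntegrable (fun x => |f x| ^ p) MeasureTheory.volume 0 1

noncomputable def Delta (r : ℕ) (h : ℝ) (f : ℝ → ℝ) (x : ℝ) : ℝ :=
  ∑ ν ∈ Finset.range (r + 1), ((-1 : ℝ) ^ ν * (r.choose ν : ℝ)) * f (x + ((r : ℝ) - (ν : ℝ)) * h)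

noncomputable def omegaMod (r : ℕ) (p : ℝ) (f : ℝ → ℝ) (δ : ℝ) : ℝ :=
  sSup {y | ∃ h : ℝ, 0 < h ∧ h < δ ∧ y = LpNorm p (Delta r h f)}

noncomputable def steklov (r : ℕ) (δ : ℝ) (f : ℝ → ℝ) (x : ℝ) : ℝ :=
  (-1 : ℝ) ^ (r + 1) * (((2 * r).choose r : ℝ))⁻¹ * (2 / δ) *
    ∫ t in (-(δ / 2))..(δ / 2),
      ∑ ν ∈ Finset.range r,
        (-1 : ℝ) ^ ν * (((2 * r).choose ν : ℝ)) * f (x + (((r : ℝ) - (ν : ℝ)) / (r : ℝ)) * t)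

noncomputable def ellp (p : ℝ) (n : ℕ) (x : ℕ → ℝ) (f : ℝ → ℝ) : ℝ :=
  ((1 / (n : ℝ)) * ∑ k ∈ Finset.range n, |f (x k)| ^ p) ^ (1 / p)

def SobolevW (s : ℕ) (g : ℝ → ℝ) : Prop :=
  Function.Periodic g 1 ∧ ContDiff ℝ (s : ℕ∞) g

noncomputable def localMod (r : ℕ) (f : ℝ → ℝ) (x δ : ℝ) : ℝ :=
  sSup {y | ∃ t h : ℝ, t ∈ Set.Icc (x - r * δ / 2) (x + r * δ / 2) ∧
    (t + r * h) ∈ Set.Icc (x - r * δ / 2) (x + r * δ / 2) ∧ y = |Delta r h f t|}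

noncomputable def tauMod (r : ℕ) (p : ℝ) (f : ℝ → ℝ) (δ : ℝ) : ℝ :=
  (∫ x in (0:ℝ)..1, localMod r f x δ ^ p) ^ (1 / p)

def IsTrigPoly (n : ℕ) (T : ℝ → ℝ) : Prop :=
  ∃ c : ℤ → ℂ, ∀ x : ℝ, (T x : ℂ) =
    ∑ ℓ ∈ Finset.Icc (-(n : ℤ)) (n : ℤ),
      c ℓ * Complex.exp (2 * Real.pi * Complex.I * (ℓ : ℂ) * (x : ℂ))

noncomputable def tildeE (n : ℕ) (p : ℝ) (f : ℝ → ℝ) : ℝ :=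
  sInf {y | ∃ Q q : ℝ → ℝ, IsTrigPoly n Q ∧ IsTrigPoly n q ∧
    (∀ x, q x ≤ f x ∧ f x ≤ Q x) ∧ y = LpNorm p (fun x => Q x - q x)}

noncomputable def dirichlet (n : ℕ) (x : ℝ) : ℝ :=
  ∑ ℓ ∈ Finset.Icc (-(n : ℤ)) (n : ℤ), Real.cos (2 * Real.pi * (ℓ : ℝ) * x)

noncomputable def lagrange (n : ℕ) (f : ℝ → ℝ) (x : ℝ) : ℝ :=
  (1 / (2 * (n : ℝ) + 1)) * ∑ k ∈ Finset.range (2 * n + 1),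
    f ((k : ℝ) / (2 * (n : ℝ) + 1)) * dirichlet n (x - (k : ℝ) / (2 * (n : ℝ) + 1))

def NodesOK (γ : ℝ) (X : ℕ → ℕ → ℝ) : Prop :=
  ∀ n : ℕ, 1 ≤ n →
    (0 ≤ X n 0) ∧ (∀ k, k + 1 < n → X n k < X n (k + 1)) ∧ (X n (n - 1) < 1) ∧
    (∀ k, k + 1 < n → γ / (n : ℝ) ≤ X n (k + 1) - X n k) ∧
    (γ / (n : ℝ) ≤ 1 + X n 0 - X n (n - 1))

def NodesOrd (X : ℕ → ℕ → ℝ) : Prop :=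
  ∀ n : ℕ, 1 ≤ n →
    (0 ≤ X n 0) ∧ (∀ k, k + 1 < n → X n k < X n (k + 1)) ∧ (X n (n - 1) < 1)

def SamplingForm (p : ℝ) (X : ℕ → ℕ → ℝ) (φ : ℕ → ℕ → ℝ → ℝ)
    (G : ℕ → (ℝ → ℝ) → ℝ → ℝ) : Prop :=
  (∀ n k, MemLpT p (φ n k)) ∧
  ∀ (n : ℕ) (f : ℝ → ℝ) (x : ℝ), G n f x = ∑ k ∈ Finset.range n, f (X n k) * φ n k x

def CondC1 (p K1 : ℝ) (X : ℕ → ℕ → ℝ) (G : ℕ → (ℝ → ℝ) → ℝ → ℝ) : Prop :=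
  ∀ f : ℝ → ℝ, MemLpT p f → ∀ n : ℕ, 1 ≤ n → LpNorm p (G n f) ≤ K1 * ellp p n (X n) f

def CondC1' (p K2 : ℝ) (X : ℕ → ℕ → ℝ) (G : ℕ → (ℝ → ℝ) → ℝ → ℝ) : Prop :=
  ∀ f : ℝ → ℝ, MemLpT p f → ∀ n : ℕ, 1 ≤ n → K2 * ellp p n (X n) f ≤ LpNorm p (G n f)

def CondC2' (p K3 : ℝ) (s : ℕ) (G : ℕ → (ℝ → ℝ) → ℝ → ℝ) : Prop :=
  ∀ g : ℝ → ℝ, SobolevW s g → ∀ n : ℕ, 1 ≤ n →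
    LpNorm p (fun x => g x - G n g x) ≤ K3 / (n : ℝ) ^ s * LpNorm p (iteratedDeriv s g)

def CondC3 (p K5 : ℝ) (s : ℕ) (G : ℕ → (ℝ → ℝ) → ℝ → ℝ) : Prop :=
  ∀ f : ℝ → ℝ, MemLpT p f → ∀ n : ℕ, 1 ≤ n →
    SobolevW s (G n f) ∧
    (1 / (n : ℝ) ^ s) * LpNorm p (iteratedDeriv s (G n f)) ≤
      K5 * omegaMod s p (G n f) (1 / (n : ℝ))

noncomputable def Gprev (G : ℕ → (ℝ → ℝ) → ℝ → ℝ) (f : ℝ → ℝ) (ν : ℕ) : ℝ → ℝ :=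
  if ν = 0 then fun _ => 0 else G (2 ^ (ν - 1)) f

def CondC4 (p K4 : ℝ) (s : ℕ) (G : ℕ → (ℝ → ℝ) → ℝ → ℝ) (f : ℝ → ℝ) : Prop :=
  ∀ ν : ℕ,
    SobolevW s (fun x => G (2 ^ ν) f x - Gprev G f ν x) ∧
    LpNorm p (iteratedDeriv s (fun x => G (2 ^ ν) f x - Gprev G f ν x)) ≤
      K4 * 2 ^ (s * ν) * LpNorm p (fun x => G (2 ^ ν) f x - Gprev G f ν x)

noncomputable def Kfun (s : ℕ) (p : ℝ) (n : ℕ) (x : ℕ → ℝ) (f : ℝ → ℝ) : ℝ :=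
  sInf {y | ∃ g : ℝ → ℝ, SobolevW s g ∧
    y = ellp p n x (fun t => f t - g t) + LpNorm p (fun t => f t - g t) +
        (1 / (n : ℝ) ^ s) * LpNorm p (iteratedDeriv s g)}


/-! ### Basic facts on `LpNorm` -/

lemma memLpT_iff {p : ℝ} (hp : 1 ≤ p) {f : ℝ → ℝ} :
    MemLpT p f ↔ Function.Periodic f 1 ∧ Measurable f ∧
      MemLp f (ENNReal.ofReal p) (volume.restrict (Set.Ioc (0:ℝ) 1)) := by
  have hp0 : 0 < p := by linarith
  unfold MemLpT
  refine and_congr_right fun _ => and_congr_right fun hm => ?_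
  rw [intervalIntegrable_iff_integrableOn_Ioc_of_le zero_le_one, IntegrableOn,
    ← integrable_norm_rpow_iff hm.aestronglyMeasurable (by simpa using hp0) (by simp),
    ENNReal.toReal_ofReal hp0.le]
  rfl

lemma LpNorm_eq {p : ℝ} (hp : 1 ≤ p) {f : ℝ → ℝ} (hf : MemLpT p f) :
    LpNorm p f = (eLpNorm f (ENNReal.ofReal p) (volume.restrict (Set.Ioc (0:ℝ) 1))).toReal := by
  have hp0 : 0 < p := by linarith
  rw [((memLpT_iff hp).1 hf).2.2.eLpNorm_eq_integral_rpow_norm (by simpa using hp0) (by simp),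
    ENNReal.toReal_ofReal hp0.le, ENNReal.toReal_ofReal (by positivity), LpNorm,
    intervalIntegral.integral_of_le zero_le_one, one_div]
  rfl

lemma LpNorm_nonneg (p : ℝ) (f : ℝ → ℝ) : 0 ≤ LpNorm p f := by
  unfold LpNorm
  apply Real.rpow_nonneg
  apply intervalIntegral.integral_nonneg zero_le_one
  intro x _
  positivity

lemma LpNorm_congr_abs (p : ℝ) {f g : ℝ → ℝ} (h : ∀ x, |f x| = |g x|) :
    LpNorm p f = LpNorm p g := by
  unfold LpNorm
  simp [h]

lemma memLpT_add {p : ℝ} (hp : 1 ≤ p) {f g : ℝ → ℝ} (hf : MemLpT p f) (hg : MemLpT p g) :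
    MemLpT p (fun x => f x + g x) := by
  rw [memLpT_iff hp] at *
  exact ⟨hf.1.add hg.1, hf.2.1.add hg.2.1, hf.2.2.add hg.2.2⟩

lemma memLpT_sub {p : ℝ} (hp : 1 ≤ p) {f g : ℝ → ℝ} (hf : MemLpT p f) (hg : MemLpT p g) :
    MemLpT p (fun x => f x - g x) := by
  rw [memLpT_iff hp] at *
  exact ⟨hf.1.sub hg.1, hf.2.1.sub hg.2.1, hf.2.2.sub hg.2.2⟩

lemma memLpT_zero {p : ℝ} (hp : 1 ≤ p) : MemLpT p (fun _ => 0) := by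
  rw [memLpT_iff hp]
  exact ⟨fun _ => rfl, measurable_const, MemLp.zero⟩

lemma memLpT_const_mul {p : ℝ} (hp : 1 ≤ p) (c : ℝ) {f : ℝ → ℝ} (hf : MemLpT p f) :
    MemLpT p (fun x => c * f x) := by
  rw [memLpT_iff hp] at *
  refine ⟨fun x => ?_, hf.2.1.const_mul c, hf.2.2.const_mul c⟩
  simp only [hf.1 x]

lemma memLpT_sum {p : ℝ} (hp : 1 ≤ p) {ι : Type*} (S : Finset ι) {f : ι → ℝ → ℝ}
    (hf : ∀ i ∈ S, MemLpT p (f i)) : MemLpT p (fun x => ∑ i ∈ S, f i x) := by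
  classical
  induction S using Finset.induction_on with
  | empty => simpa using memLpT_zero hp
  | insert a S ha ih =>
    simp only [Finset.sum_insert ha]
    exact memLpT_add hp (hf a (by simp)) (ih fun i hi => hf i (by simp [hi]))

lemma memLpT_of_continuous {p : ℝ} (hp : 1 ≤ p) {f : ℝ → ℝ} (hf : Continuous f)
    (hper : Function.Periodic f 1) : MemLpT p f := by
  refine ⟨hper, hf.measurable, Continuous.intervalIntegrable ?_ _ _⟩
  exact hf.abs.rpow_const fun _ => Or.inr (by linarith)

lemma LpNorm_add_le {p : ℝ} (hp : 1 ≤ p) {f g : ℝ → ℝ} (hf : MemLpT p f) (hg : MemLpT p g) :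
    LpNorm p (fun x => f x + g x) ≤ LpNorm p f + LpNorm p g := by
  rw [LpNorm_eq hp hf, LpNorm_eq hp hg, LpNorm_eq hp (memLpT_add hp hf hg)]
  rw [memLpT_iff hp] at hf hg
  rw [← ENNReal.toReal_add hf.2.2.eLpNorm_ne_top hg.2.2.eLpNorm_ne_top]
  apply ENNReal.toReal_mono
  · exact ENNReal.add_ne_top.2 ⟨hf.2.2.eLpNorm_ne_top, hg.2.2.eLpNorm_ne_top⟩
  · exact eLpNorm_add_le hf.2.1.aestronglyMeasurable hg.2.1.aestronglyMeasurable (by simpa using hp)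

lemma LpNorm_const_mul {p : ℝ} (hp : 1 ≤ p) (c : ℝ) {f : ℝ → ℝ} :
    LpNorm p (fun x => c * f x) = |c| * LpNorm p f := by
  unfold LpNorm
  have : ∀ x, |c * f x| ^ p = |c| ^ p * |f x| ^ p := fun x => by
    rw [abs_mul, Real.mul_rpow (abs_nonneg _) (abs_nonneg _)]
  simp only [this]
  rw [intervalIntegral.integral_const_mul, Real.mul_rpow (by positivity)
    (intervalIntegral.integral_nonneg zero_le_one fun x _ => by positivity), one_div,
    Real.rpow_rpow_inv (abs_nonneg _) (by linarith)]

lemma LpNorm_neg (p : ℝ) (f : ℝ → ℝ) : LpNorm p (fun x => - f x) = LpNorm p f :=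
  LpNorm_congr_abs p fun x => abs_neg _

lemma LpNorm_sub_le {p : ℝ} (hp : 1 ≤ p) {f g : ℝ → ℝ} (hf : MemLpT p f) (hg : MemLpT p g) :
    LpNorm p (fun x => f x - g x) ≤ LpNorm p f + LpNorm p g := by
  have hg' : MemLpT p (fun x => - g x) := by
    simpa using memLpT_const_mul hp (-1) hg
  have := LpNorm_add_le hp hf hg'
  rw [LpNorm_neg] at this
  simpa [sub_eq_add_neg] using this

lemma LpNorm_sum_le {p : ℝ} (hp : 1 ≤ p) {ι : Type*} (S : Finset ι) {f : ι → ℝ → ℝ}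
    (hf : ∀ i ∈ S, MemLpT p (f i)) :
    LpNorm p (fun x => ∑ i ∈ S, f i x) ≤ ∑ i ∈ S, LpNorm p (f i) := by
  classical
  induction S using Finset.induction_on with
  | empty =>
    simp only [Finset.sum_empty, LpNorm]
    have : p ≠ 0 := by linarith
    simp [Real.zero_rpow, this]
  | insert a S ha ih =>
    simp only [Finset.sum_insert ha]
    refine (LpNorm_add_le hp (hf a (by simp))
      (memLpT_sum hp S fun i hi => hf i (by simp [hi]))).trans ?_
    gcongr
    exact ih fun i hi => hf i (by simp [hi])

lemma periodic_abs_rpow {p : ℝ} {f : ℝ → ℝ} (hf : Function.Periodic f 1) :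
    Function.Periodic (fun x => |f x| ^ p) 1 := fun x => by simp only [hf x]

lemma memLpT_translate {p : ℝ} {f : ℝ → ℝ} (hf : MemLpT p f) (a : ℝ) :
    MemLpT p (fun x => f (x + a)) := by
  refine ⟨fun x => ?_, hf.2.1.comp (measurable_id.add_const a), ?_⟩
  · have := hf.1 (x + a)
    simp only
    rw [← this]; ring_nf
  · have h := (periodic_abs_rpow (p := p) hf.1).intervalIntegrable₀ one_ne_zero hf.2.2 (0 + a) (1 + a)
    have := h.comp_add_right a
    simpa using this

lemma LpNorm_translate {p : ℝ} {f : ℝ → ℝ} (hf : Function.Periodic f 1) (a : ℝ) :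
    LpNorm p (fun x => f (x + a)) = LpNorm p f := by
  unfold LpNorm
  rw [intervalIntegral.integral_comp_add_right (fun x => |f x| ^ p) a]
  have := (periodic_abs_rpow (p := p) hf).intervalIntegral_add_eq (0 + a) 0
  rw [show (0:ℝ) + a + 1 = 1 + a by ring, zero_add (1:ℝ)] at this
  rw [this]

lemma memLpT_intervalIntegrable_rpow {p : ℝ} {f : ℝ → ℝ} (hf : MemLpT p f) (a b : ℝ) :
    IntervalIntegrable (fun x => |f x| ^ p) volume a b :=
  (periodic_abs_rpow (p := p) hf.1).intervalIntegrable₀ one_ne_zero hf.2.2 a b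

lemma memLpT_intervalIntegrable {p : ℝ} (hp : 1 ≤ p) {f : ℝ → ℝ} (hf : MemLpT p f) (a b : ℝ) :
    IntervalIntegrable f volume a b := by
  refine hf.1.intervalIntegrable₀ one_ne_zero ?_ a b
  rw [intervalIntegrable_iff_integrableOn_Ioc_of_le zero_le_one, IntegrableOn]
  exact ((memLpT_iff hp).1 hf).2.2.integrable (by simpa using hp)

/-- Jensen. -/
lemma jensen_interval {p : ℝ} (hp : 1 ≤ p) {f : ℝ → ℝ} (hf : MemLpT p f) {a b : ℝ} (hab : a < b) :
    ((b - a)⁻¹ * ∫ x in a..b, |f x|) ^ p ≤ (b - a)⁻¹ * ∫ x in a..b, |f x| ^ p := by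
  have h := (convexOn_rpow hp).map_set_average_le (μ := volume) (t := Set.Ioc a b)
    (f := fun x => |f x|) (g := fun y : ℝ => y ^ p)
    (fun x _ => (Real.continuousAt_rpow_const x p (Or.inr (by linarith))).continuousWithinAt)
    isClosed_Ici (by simp [hab]) (by simp) (Eventually.of_forall fun x => Set.mem_Ici.2 (abs_nonneg _))
    ((intervalIntegrable_iff_integrableOn_Ioc_of_le hab.le).1
      (memLpT_intervalIntegrable hp hf a b).abs)
    ((intervalIntegrable_iff_integrableOn_Ioc_of_le hab.le).1
      (memLpT_intervalIntegrable_rpow hf a b))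
  rw [intervalIntegral.integral_of_le hab.le, intervalIntegral.integral_of_le hab.le]
  simp only [setAverage_eq, Real.volume_real_Ioc_of_le hab.le, smul_eq_mul] at h
  exact h

/-! ### `ellp` -/

lemma ellp_nonneg (p : ℝ) (n : ℕ) (x : ℕ → ℝ) (f : ℝ → ℝ) : 0 ≤ ellp p n x f := by
  unfold ellp; positivity

lemma ellp_add_le {p : ℝ} (hp : 1 ≤ p) (n : ℕ) (x : ℕ → ℝ) (f g : ℝ → ℝ) :
    ellp p n x (fun t => f t + g t) ≤ ellp p n x f + ellp p n x g := by
  unfold ellp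
  rw [Real.mul_rpow (by positivity) (by positivity), Real.mul_rpow (by positivity) (by positivity),
    Real.mul_rpow (by positivity) (by positivity), ← mul_add]
  gcongr
  exact Real.Lp_add_le _ _ _ hp

lemma node_sum_le {γ : ℝ} {X : ℕ → ℕ → ℝ} (hγ0 : 0 < γ) (hX : NodesOK γ X) {n : ℕ} (hn : 1 ≤ n)
    {F : ℝ → ℝ} (hF0 : ∀ x, 0 ≤ F x) (hper : Function.Periodic F 1)
    (hF : ∀ a b, IntervalIntegrable F volume a b) :
    ∑ k ∈ Finset.range n, ∫ u in (X n k - γ / n / 2)..(X n k + γ / n / 2), F u ≤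
      ∫ u in (0:ℝ)..1, F u := by
  obtain ⟨h0, h1, h2, h3, h4⟩ := hX n hn
  set δ := γ / (n:ℝ) with hδ
  have hδ0 : 0 < δ := by have : (0:ℝ) < n := by exact_mod_cast hn
                         positivity
  have key : ∀ m, m < n → X n 0 ≤ X n m ∧
      ∑ k ∈ Finset.range (m + 1), ∫ u in (X n k - δ / 2)..(X n k + δ / 2), F u ≤
      ∫ u in (X n 0 - δ / 2)..(X n m + δ / 2), F u := by
    intro m
    induction m with
    | zero => intro _; simp
    | succ m ih =>
      intro hm
      obtain ⟨i1, i2⟩ := ih (by omega)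
      have h3m := h3 m hm
      refine ⟨by linarith, ?_⟩
      rw [Finset.sum_range_succ]
      have e1 : ∫ u in (X n (m+1) - δ / 2)..(X n (m+1) + δ / 2), F u ≤
          ∫ u in (X n m + δ / 2)..(X n (m+1) + δ / 2), F u :=
        intervalIntegral.integral_mono_interval (by linarith) (by linarith) le_rfl
          (Eventually.of_forall fun x => hF0 x) (hF _ _)
      have e2 := intervalIntegral.integral_add_adjacent_intervals (hF (X n 0 - δ/2) (X n m + δ / 2))
        (hF (X n m + δ / 2) (X n (m+1) + δ / 2))
      linarith
  obtain ⟨k1, k2⟩ := key (n - 1) (by omega)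
  rw [Nat.sub_add_cancel hn] at k2
  refine k2.trans ?_
  have e := hper.intervalIntegral_add_eq (X n 0 - δ / 2) 0
  rw [zero_add] at e
  rw [← e]
  exact intervalIntegral.integral_mono_interval le_rfl (by linarith) (by linarith)
          (Eventually.of_forall fun x => hF0 x) (hF _ _)

lemma ellp_local_le {p γ : ℝ} (hp : 1 ≤ p) {X : ℕ → ℕ → ℝ} (hγ0 : 0 < γ)
    (hX : NodesOK γ X) {n : ℕ} (hn : 1 ≤ n) {F H : ℝ → ℝ} (hH : MemLpT p H) {A : ℝ} (hA : 0 ≤ A)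
    (hF : ∀ x, |F x| ≤ A * ((γ / n)⁻¹ * ∫ u in (x - γ / n / 2)..(x + γ / n / 2), |H u|)) :
    ellp p n (X n) F ≤ A * (γ⁻¹) ^ (1 / p) * LpNorm p H := by
  have hn0 : (0:ℝ) < n := by exact_mod_cast hn
  have hp0 : 0 < p := by linarith
  set δ := γ / (n:ℝ) with hδ
  have hδ0 : 0 < δ := by positivity
  have hI0 : 0 ≤ ∫ x in (0:ℝ)..1, |H x| ^ p :=
    intervalIntegral.integral_nonneg zero_le_one fun x _ => by positivity
  have h1 : ∀ x, |F x| ^ p ≤ A ^ p * (δ⁻¹ * ∫ u in (x - δ / 2)..(x + δ / 2), |H u| ^ p) := by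
    intro x
    have hx := hF x
    have hj := jensen_interval hp hH (show x - δ / 2 < x + δ / 2 by linarith)
    rw [show x + δ / 2 - (x - δ / 2) = δ by ring] at hj
    calc |F x| ^ p ≤ (A * (δ⁻¹ * ∫ u in (x - δ / 2)..(x + δ / 2), |H u|)) ^ p := by gcongr
      _ = A ^ p * (δ⁻¹ * ∫ u in (x - δ / 2)..(x + δ / 2), |H u|) ^ p := by
        rw [Real.mul_rpow hA]
        have : 0 ≤ ∫ u in (x - δ / 2)..(x + δ / 2), |H u| :=
          intervalIntegral.integral_nonneg (by linarith) fun x _ => abs_nonneg _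
        positivity
      _ ≤ _ := by gcongr
  have h2 : (1 / (n:ℝ)) * ∑ k ∈ Finset.range n, |F (X n k)| ^ p ≤
      A ^ p * γ⁻¹ * ∫ x in (0:ℝ)..1, |H x| ^ p := by
    calc (1 / (n:ℝ)) * ∑ k ∈ Finset.range n, |F (X n k)| ^ p
        ≤ (1 / (n:ℝ)) * ∑ k ∈ Finset.range n,
          A ^ p * (δ⁻¹ * ∫ u in (X n k - δ / 2)..(X n k + δ / 2), |H u| ^ p) := by
          gcongr; exact h1 _
      _ = (1 / (n:ℝ)) * δ⁻¹ * A ^ p * ∑ k ∈ Finset.range n,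
          ∫ u in (X n k - δ / 2)..(X n k + δ / 2), |H u| ^ p := by
          rw [← Finset.mul_sum, ← Finset.mul_sum]; ring
      _ ≤ (1 / (n:ℝ)) * δ⁻¹ * A ^ p * ∫ x in (0:ℝ)..1, |H x| ^ p := by
          gcongr
          exact node_sum_le hγ0 hX hn (fun x => by positivity) (periodic_abs_rpow hH.1)
            (memLpT_intervalIntegrable_rpow hH)
      _ = _ := by
          rw [hδ]; field_simp
  calc ellp p n (X n) F ≤ (A ^ p * γ⁻¹ * ∫ x in (0:ℝ)..1, |H x| ^ p) ^ (1 / p) := by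
        unfold ellp; gcongr
    _ = _ := by
        rw [Real.mul_rpow (by positivity) hI0, Real.mul_rpow (by positivity) (by positivity),
          LpNorm, ← Real.rpow_mul hA, mul_one_div_cancel hp0.ne', Real.rpow_one]

/-! ### Finite differences -/

lemma Delta_eq_iter (r : ℕ) (h : ℝ) (f : ℝ → ℝ) (x : ℝ) :
    Delta r h f x = (fwdDiff h)^[r] f x := by
  rw [fwdDiff_iter_eq_sum_shift, Delta, ← Finset.sum_range_reflect]
  refine Finset.sum_congr rfl fun k hk => ?_
  have hk' : k ≤ r := by simpa [Nat.lt_succ_iff] using hk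
  rw [show r + 1 - 1 - k = r - k by omega, Nat.choose_symm hk', Nat.cast_sub hk']
  simp only [nsmul_eq_mul, zsmul_eq_mul]
  push_cast
  rw [show (r:ℝ) - (r - k) = k by ring]

lemma Delta_succ (r : ℕ) (h : ℝ) (f : ℝ → ℝ) (x : ℝ) :
    Delta (r + 1) h f x = Delta r h f (x + h) - Delta r h f x := by
  simp only [Delta_eq_iter, Function.iterate_succ_apply', fwdDiff]

lemma Delta_hasDerivAt (r : ℕ) (h : ℝ) {f f' : ℝ → ℝ} (hf : ∀ x, HasDerivAt f (f' x) x) (x : ℝ) :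
    HasDerivAt (Delta r h f) (Delta r h f' x) x := by
  induction r generalizing x with
  | zero =>
    have e : ∀ g : ℝ → ℝ, Delta 0 h g = g := fun g => by funext y; simp [Delta]
    rw [e, e]; exact hf x
  | succ r ih =>
    have e : Delta (r + 1) h f = fun x => Delta r h f (x + h) - Delta r h f x := by
      funext y; exact Delta_succ r h f y
    rw [e, Delta_succ]
    exact ((ih (x + h)).comp_add_const x h).sub (ih x)

lemma contDiff_succ_data {k : ℕ} {g : ℝ → ℝ} (hg : ContDiff ℝ ((k + 1 : ℕ) : ℕ∞) g) :
    (∀ x, HasDerivAt g (deriv g x) x) ∧ ContDiff ℝ (k : ℕ∞) (deriv g) := by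
  have h : ContDiff ℝ ((k : WithTop ℕ∞) + 1) g := by
    have : (((k + 1 : ℕ) : ℕ∞) : WithTop ℕ∞) = (k : WithTop ℕ∞) + 1 := by norm_cast
    rwa [this] at hg
  rw [contDiff_succ_iff_deriv] at h
  exact ⟨fun x => (h.1 x).hasDerivAt, h.2.2⟩

lemma continuous_iterDeriv {k : ℕ} {g : ℝ → ℝ} (hg : ContDiff ℝ (k : ℕ∞) g) :
    Continuous (iteratedDeriv k g) :=
  hg.continuous_iteratedDeriv k le_rfl

lemma Delta_pointwise (k : ℕ) {h : ℝ} (hh : 0 ≤ h) {g : ℝ → ℝ}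
    (hg : ContDiff ℝ ((k + 1 : ℕ) : ℕ∞) g) (y : ℝ) :
    |Delta (k + 1) h g y| ≤ h ^ k * ∫ u in y..(y + ((k + 1 : ℕ) : ℝ) * h),
      |iteratedDeriv (k + 1) g u| := by
  induction k generalizing g y with
  | zero =>
    obtain ⟨h1, h2⟩ := contDiff_succ_data hg
    have hc : Continuous (deriv g) := h2.continuous
    have e : Delta (0 + 1) h g y = ∫ u in y..(y + h), deriv g u := by
      rw [intervalIntegral.integral_eq_sub_of_hasDerivAt (fun x _ => h1 x)
        (hc.intervalIntegrable _ _), Delta_succ]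
      simp [Delta]
    rw [e]
    simp only [zero_add, iteratedDeriv_one, pow_zero, one_mul, Nat.cast_one]
    exact intervalIntegral.abs_integral_le_integral_abs (by linarith)
  | succ k ih =>
    obtain ⟨h1, h2⟩ := contDiff_succ_data hg
    have hcont : Continuous fun u => |iteratedDeriv (k + 1 + 1) g u| :=
      (continuous_iterDeriv hg).abs
    rw [Delta_succ]
    have hk : (0:ℝ) ≤ ((k + 1 : ℕ) : ℝ) := by positivity
    have hkh : (0:ℝ) ≤ ((k + 1 : ℕ) : ℝ) * h := by positivity
    have := Convex.norm_image_sub_le_of_norm_hasDerivWithin_le (s := Set.Icc y (y + h))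
      (f := Delta (k + 1) h g) (f' := Delta (k + 1) h (deriv g)) (x := y) (y := y + h)
      (C := h ^ k * ∫ u in y..(y + ((k + 1 + 1 : ℕ) : ℝ) * h), |iteratedDeriv (k + 1 + 1) g u|)
      (fun x _ => (Delta_hasDerivAt (k + 1) h h1 x).hasDerivWithinAt) ?_ (convex_Icc _ _)
      (by simp [hh]) (by simp [hh])
    · rw [Real.norm_eq_abs, Real.norm_eq_abs, add_sub_cancel_left, abs_of_nonneg hh] at this
      refine this.trans (le_of_eq ?_)
      ring
    · intro ξ hξ
      refine (ih h2 ξ).trans ?_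
      rw [← iteratedDeriv_succ']
      gcongr
      refine intervalIntegral.integral_mono_interval hξ.1 (by linarith) ?_
        (Eventually.of_forall fun x => abs_nonneg _) (hcont.intervalIntegrable _ _)
      have := hξ.2
      push_cast at *
      linarith

lemma Delta_pointwise_ge (k j : ℕ) {h : ℝ} (hh : 0 ≤ h) {g : ℝ → ℝ}
    (hg : ContDiff ℝ ((k + 1 : ℕ) : ℕ∞) g) (y : ℝ) :
    |Delta (k + 1 + j) h g y| ≤ 2 ^ j * (h ^ k * ∫ u in y..(y + ((k + 1 + j : ℕ) : ℝ) * h),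
      |iteratedDeriv (k + 1) g u|) := by
  have hcont : Continuous fun u => |iteratedDeriv (k + 1) g u| :=
      (continuous_iterDeriv hg).abs
  induction j generalizing y with
  | zero => simpa using Delta_pointwise k hh hg y
  | succ j ih =>
    rw [← add_assoc, Delta_succ]
    have hk : (0:ℝ) ≤ ((k + 1 + j : ℕ) : ℝ) * h := by positivity
    have a1 := ih y
    have a2 := ih (y + h)
    have b1 : ∫ u in y..(y + ((k + 1 + j : ℕ) : ℝ) * h), |iteratedDeriv (k + 1) g u| ≤
        ∫ u in y..(y + ((k + 1 + j + 1 : ℕ) : ℝ) * h), |iteratedDeriv (k + 1) g u| := by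
      refine intervalIntegral.integral_mono_interval le_rfl (by linarith) ?_
        (Eventually.of_forall fun x => abs_nonneg _) (hcont.intervalIntegrable _ _)
      push_cast; linarith
    have b2 : ∫ u in (y + h)..(y + h + ((k + 1 + j : ℕ) : ℝ) * h), |iteratedDeriv (k + 1) g u| ≤
        ∫ u in y..(y + ((k + 1 + j + 1 : ℕ) : ℝ) * h), |iteratedDeriv (k + 1) g u| := by
      refine intervalIntegral.integral_mono_interval (by linarith) (by linarith) ?_
        (Eventually.of_forall fun x => abs_nonneg _) (hcont.intervalIntegrable _ _)
      push_cast; linarith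
    set I := ∫ u in y..(y + ((k + 1 + j + 1 : ℕ) : ℝ) * h), |iteratedDeriv (k + 1) g u|
    have c1 : |Delta (k + 1 + j) h g y| ≤ 2 ^ j * (h ^ k * I) := a1.trans (by gcongr)
    have c2 : |Delta (k + 1 + j) h g (y + h)| ≤ 2 ^ j * (h ^ k * I) := a2.trans (by gcongr)
    calc _ ≤ |Delta (k + 1 + j) h g (y + h)| + |Delta (k + 1 + j) h g y| := abs_sub _ _
      _ ≤ 2 ^ (j + 1) * (h ^ k * I) := by rw [pow_succ]; linarith

lemma iterDeriv_periodic {s : ℕ} {g : ℝ → ℝ} (hg : Function.Periodic g 1) :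
    Function.Periodic (iteratedDeriv s g) 1 := by
  intro x
  have e : (fun z => g (z + 1)) = g := funext hg
  have := congrFun (iteratedDeriv_comp_add_const s g 1) x
  rw [e] at this
  exact this.symm

lemma memLpT_iterDeriv {p : ℝ} (hp : 1 ≤ p) {s : ℕ} {g : ℝ → ℝ} (hg : SobolevW s g) :
    MemLpT p (iteratedDeriv s g) :=
  memLpT_of_continuous hp (continuous_iterDeriv hg.2) (iterDeriv_periodic hg.1)

lemma swap_cont {F : ℝ → ℝ → ℝ} (hF : Continuous (Function.uncurry F)) {L : ℝ} (hL : 0 ≤ L) :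
    ∫ y in (0:ℝ)..1, ∫ u in (0:ℝ)..L, F y u = ∫ u in (0:ℝ)..L, ∫ y in (0:ℝ)..1, F y u := by
  simp only [intervalIntegral.integral_of_le zero_le_one, intervalIntegral.integral_of_le hL]
  apply integral_integral_swap
  rw [Measure.prod_restrict]
  refine IntegrableOn.mono_set (t := Set.Icc (0:ℝ) 1 ×ˢ Set.Icc (0:ℝ) L) ?_
    (Set.prod_mono Set.Ioc_subset_Icc_self Set.Ioc_subset_Icc_self)
  exact hF.continuousOn.integrableOn_compact (isCompact_Icc.prod isCompact_Icc)

lemma LpNorm_Delta_smooth {p : ℝ} (hp : 1 ≤ p) {s : ℕ} (hs : 1 ≤ s) {g : ℝ → ℝ}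
    (hg : SobolevW s g) {h : ℝ} (hh : 0 < h) :
    LpNorm p (Delta s h g) ≤ s * h ^ s * LpNorm p (iteratedDeriv s g) := by
  obtain ⟨k, rfl⟩ : ∃ k, s = k + 1 := ⟨s - 1, by omega⟩
  have hp0 : 0 < p := by linarith
  have hD := memLpT_iterDeriv hp hg
  have hDc := continuous_iterDeriv hg.2
  set D := iteratedDeriv (k + 1) g with hDdef
  set L : ℝ := ((k + 1 : ℕ) : ℝ) * h with hL
  have hL0 : 0 < L := by positivity
  have hgc : Continuous g := hg.2.continuous
  have hDelc : Continuous (Delta (k + 1) h g) := by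
    unfold Delta; fun_prop
  have hDp : Continuous (Function.uncurry fun y u => |D (y + u)| ^ p) := by
    refine Continuous.rpow_const ?_ fun _ => Or.inr hp0.le
    exact (hDc.comp (continuous_fst.add continuous_snd)).abs
  have hpt : ∀ y, |Delta (k + 1) h g y| ^ p ≤
      (h ^ k * L) ^ p * (L⁻¹ * ∫ u in (0:ℝ)..L, |D (y + u)| ^ p) := by
    intro y
    have h1 := Delta_pointwise k hh.le hg.2 y
    have hj := jensen_interval hp hD (show y < y + L by linarith)
    rw [add_sub_cancel_left] at hj
    have hI : 0 ≤ ∫ u in y..(y + L), |D u| :=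
      intervalIntegral.integral_nonneg (by linarith) fun x _ => abs_nonneg _
    have e : ∫ u in (0:ℝ)..L, |D (y + u)| ^ p = ∫ u in y..(y + L), |D u| ^ p := by
      rw [intervalIntegral.integral_comp_add_left (fun u => |D u| ^ p) y, add_zero]
    rw [e]
    calc |Delta (k + 1) h g y| ^ p ≤ ((h ^ k * L) * (L⁻¹ * ∫ u in y..(y + L), |D u|)) ^ p := by
          gcongr
          refine h1.trans (le_of_eq ?_)
          rw [mul_assoc, mul_inv_cancel_left₀ hL0.ne']
      _ = (h ^ k * L) ^ p * (L⁻¹ * ∫ u in y..(y + L), |D u|) ^ p := by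
          rw [Real.mul_rpow (by positivity) (by positivity)]
      _ ≤ _ := by gcongr
  have hinner : ∀ u, ∫ y in (0:ℝ)..1, |D (y + u)| ^ p = ∫ y in (0:ℝ)..1, |D y| ^ p := by
    intro u
    rw [intervalIntegral.integral_comp_add_right (fun x => |D x| ^ p) u]
    have := (periodic_abs_rpow (p := p) hD.1).intervalIntegral_add_eq (0 + u) 0
    rw [show (0:ℝ) + u + 1 = 1 + u by ring, zero_add (1:ℝ)] at this
    rw [this]
  have hI0 : 0 ≤ ∫ x in (0:ℝ)..1, |D x| ^ p :=
    intervalIntegral.integral_nonneg zero_le_one fun x _ => by positivity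
  have hint : ∫ y in (0:ℝ)..1, |Delta (k + 1) h g y| ^ p ≤
      (h ^ k * L) ^ p * ∫ y in (0:ℝ)..1, |D y| ^ p := by
    calc ∫ y in (0:ℝ)..1, |Delta (k + 1) h g y| ^ p
        ≤ ∫ y in (0:ℝ)..1, (h ^ k * L) ^ p * (L⁻¹ * ∫ u in (0:ℝ)..L, |D (y + u)| ^ p) := by
          apply intervalIntegral.integral_mono_on zero_le_one
          · exact (hDelc.abs.rpow_const fun _ => Or.inr hp0.le).intervalIntegrable _ _
          · apply Continuous.intervalIntegrable
            refine continuous_const.mul (continuous_const.mul ?_)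
            exact intervalIntegral.continuous_parametric_intervalIntegral_of_continuous' hDp 0 L
          · exact fun y _ => hpt y
      _ = (h ^ k * L) ^ p * (L⁻¹ * ∫ y in (0:ℝ)..1, ∫ u in (0:ℝ)..L, |D (y + u)| ^ p) := by
          rw [intervalIntegral.integral_const_mul, intervalIntegral.integral_const_mul]
      _ = _ := by
          rw [swap_cont hDp hL0.le]
          simp only [hinner, intervalIntegral.integral_const, sub_zero, smul_eq_mul]
          field_simp
  have h0 : 0 ≤ ∫ y in (0:ℝ)..1, |Delta (k + 1) h g y| ^ p :=
    intervalIntegral.integral_nonneg zero_le_one fun x _ => by positivity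
  calc LpNorm p (Delta (k + 1) h g)
      ≤ ((h ^ k * L) ^ p * ∫ y in (0:ℝ)..1, |D y| ^ p) ^ (1 / p) := by
        unfold LpNorm; gcongr
    _ = (h ^ k * L) * LpNorm p D := by
        rw [Real.mul_rpow (by positivity) hI0, LpNorm, ← Real.rpow_mul (by positivity),
          mul_one_div_cancel hp0.ne', Real.rpow_one]
    _ = _ := by rw [hL, pow_succ]; ring

lemma memLpT_Delta {p : ℝ} (hp : 1 ≤ p) (s : ℕ) (h : ℝ) {f : ℝ → ℝ} (hf : MemLpT p f) :
    MemLpT p (Delta s h f) := by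
  unfold Delta
  exact memLpT_sum hp _ fun i _ => memLpT_const_mul hp _ (memLpT_translate hf _)

lemma LpNorm_Delta_le {p : ℝ} (hp : 1 ≤ p) (s : ℕ) (h : ℝ) {f : ℝ → ℝ} (hf : MemLpT p f) :
    LpNorm p (Delta s h f) ≤ 2 ^ s * LpNorm p f := by
  unfold Delta
  refine (LpNorm_sum_le hp _ fun i _ =>
    memLpT_const_mul hp _ (memLpT_translate hf _)).trans (le_of_eq ?_)
  have : ∀ i ∈ Finset.range (s + 1), LpNorm p (fun x => (-1 : ℝ) ^ i * (s.choose i : ℝ) *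
      f (x + ((s:ℝ) - i) * h)) = (s.choose i : ℝ) * LpNorm p f := by
    intro i _
    rw [LpNorm_const_mul hp, LpNorm_translate hf.1, abs_mul]
    simp
  rw [Finset.sum_congr rfl this, ← Finset.sum_mul]
  congr 1
  exact_mod_cast Nat.sum_range_choose s

lemma omegaMod_le {p : ℝ} (hp : 1 ≤ p) {s : ℕ} (hs : 1 ≤ s) {f g : ℝ → ℝ} (hf : MemLpT p f)
    (hg : SobolevW s g) {δ : ℝ} (hδ : 0 < δ) :
    omegaMod s p f δ ≤ 2 ^ s * LpNorm p (fun x => f x - g x) +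
      s * δ ^ s * LpNorm p (iteratedDeriv s g) := by
  have n1 := LpNorm_nonneg p (fun x => f x - g x)
  have n2 := LpNorm_nonneg p (iteratedDeriv s g)
  have hgm : MemLpT p g := memLpT_of_continuous hp hg.2.continuous hg.1
  have hfg := memLpT_sub hp hf hgm
  apply Real.sSup_le _ (by positivity)
  rintro y ⟨h, h0, h1, rfl⟩
  have e : Delta s h f = fun x => Delta s h (fun x => f x - g x) x + Delta s h g x := by
    funext x
    simp only [Delta, ← Finset.sum_add_distrib]
    exact Finset.sum_congr rfl fun i _ => by ring
  rw [e]
  refine (LpNorm_add_le hp (memLpT_Delta hp s h hfg) (memLpT_Delta hp s h hgm)).trans ?_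
  refine add_le_add (LpNorm_Delta_le hp s h hfg) ((LpNorm_Delta_smooth hp hs hg h0).trans ?_)
  gcongr

/-! ### Steklov averages -/

lemma sum_split (r : ℕ) (F : ℕ → ℝ) :
    ∑ ν ∈ Finset.range (2 * r + 1), F ν =
      ∑ ν ∈ Finset.range r, F ν + F r + ∑ ν ∈ Finset.range r, F (2 * r - ν) := by
  rw [show 2 * r + 1 = (r + 1) + r by ring, Finset.sum_range_add, Finset.sum_range_succ]
  congr 1
  rw [← Finset.sum_range_reflect]
  refine Finset.sum_congr rfl fun k hk => ?_
  have hk' := Finset.mem_range.1 hk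
  congr 1
  omega

lemma Delta_two_mul {r : ℕ} (hr : 1 ≤ r) (g : ℝ → ℝ) (x t : ℝ) :
    Delta (2 * r) (t / r) g (x - t) =
      ∑ ν ∈ Finset.range r,
        (-1 : ℝ) ^ ν * (((2 * r).choose ν : ℝ)) * g (x + (((r : ℝ) - (ν : ℝ)) / (r : ℝ)) * t) +
      (-1 : ℝ) ^ r * ((2 * r).choose r : ℝ) * g x +
      ∑ ν ∈ Finset.range r,
        (-1 : ℝ) ^ ν * (((2 * r).choose ν : ℝ)) *
          g (x + (((r : ℝ) - (ν : ℝ)) / (r : ℝ)) * (-t)) := by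
  have hr0 : (r:ℝ) ≠ 0 := by positivity
  rw [Delta, sum_split]
  congr 1
  · congr 1
    · refine Finset.sum_congr rfl fun k _ => ?_
      congr 2
      push_cast; field_simp; ring
    · congr 2
      push_cast; field_simp; ring
  · refine Finset.sum_congr rfl fun k hk => ?_
    have hk' := Finset.mem_range.1 hk
    have hk2 : k ≤ 2 * r := by omega
    rw [Nat.choose_symm hk2, Nat.cast_sub hk2]
    congr 1
    · congr 1
      rcases Nat.even_or_odd k with hk | hk
      · rw [hk.neg_one_pow, Even.neg_one_pow]
        exact (Nat.even_sub hk2).2 (by simp [hk])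
      · rw [hk.neg_one_pow, Odd.neg_one_pow]
        exact Nat.Even.sub_odd hk2 (by simp) hk
    · congr 1
      push_cast; field_simp; ring

lemma steklov_sub_smooth {r : ℕ} (hr : 1 ≤ r) {g : ℝ → ℝ} (hg : Continuous g) {δ : ℝ} (hδ : 0 < δ)
    (x : ℝ) :
    steklov r δ g x - g x = (-1 : ℝ) ^ (r + 1) * (((2 * r).choose r : ℝ))⁻¹ * (2 / δ) *
      ∫ t in (0:ℝ)..(δ / 2), Delta (2 * r) (t / r) g (x - t) := by
  set S : ℝ → ℝ := fun t => ∑ ν ∈ Finset.range r,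
        (-1 : ℝ) ^ ν * (((2 * r).choose ν : ℝ)) * g (x + (((r : ℝ) - (ν : ℝ)) / (r : ℝ)) * t) with hS
  have hSc : Continuous S := by
    rw [hS]; fun_prop
  have hC : ((2 * r).choose r : ℝ) ≠ 0 := by
    have : 0 < (2 * r).choose r := Nat.choose_pos (by omega)
    positivity
  have e1 : ∀ t, Delta (2 * r) (t / r) g (x - t) =
      S t + (-1 : ℝ) ^ r * ((2 * r).choose r : ℝ) * g x + S (-t) := fun t => Delta_two_mul hr g x t
  have e2 : ∫ t in (-(δ/2))..(δ / 2), S t =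
      (∫ t in (0:ℝ)..(δ/2), S t) + ∫ t in (0:ℝ)..(δ / 2), S (-t) := by
    rw [intervalIntegral.integral_comp_neg, neg_zero, add_comm,
      intervalIntegral.integral_add_adjacent_intervals (hSc.intervalIntegrable _ _)
        (hSc.intervalIntegrable _ _)]
  have e3 : steklov r δ g x = (-1 : ℝ) ^ (r + 1) * (((2 * r).choose r : ℝ))⁻¹ * (2 / δ) *
    ∫ t in (-(δ/2))..(δ / 2), S t := rfl
  rw [e3, e2]
  simp only [e1]
  have f1 : IntervalIntegrable (fun t => S t + (-1 : ℝ) ^ r * ((2 * r).choose r : ℝ) * g x)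
      volume 0 (δ / 2) := (hSc.add continuous_const).intervalIntegrable _ _
  have f2 : IntervalIntegrable (fun t => S (-t)) volume 0 (δ / 2) :=
    (hSc.comp continuous_neg).intervalIntegrable _ _
  rw [intervalIntegral.integral_add f1 f2,
    intervalIntegral.integral_add (hSc.intervalIntegrable _ _)
      (continuous_const.intervalIntegrable _ _), intervalIntegral.integral_const, sub_zero,
    smul_eq_mul]
  have e4 : (-1 : ℝ) ^ (r + 1) * (((2 * r).choose r : ℝ))⁻¹ * (2 / δ) *
      (δ / 2 * ((-1 : ℝ) ^ r * ((2 * r).choose r : ℝ) * g x)) = - g x := by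
    have : (-1 : ℝ) ^ (r + 1) * (-1 : ℝ) ^ r = -1 := by
      rw [← pow_add, show r + 1 + r = 2 * r + 1 by ring, pow_succ, pow_mul]; simp
    calc _ = ((-1 : ℝ) ^ (r + 1) * (-1 : ℝ) ^ r) * g x := by field_simp
      _ = _ := by rw [this]; ring
  linear_combination -e4

lemma steklov_smooth_bound {r s : ℕ} (hr : 1 ≤ r) (hs : 1 ≤ s) (hsr : s ≤ 2 * r) {g : ℝ → ℝ}
    (hg : ContDiff ℝ (s : ℕ∞) g) {δ : ℝ} (hδ : 0 < δ) (x : ℝ) :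
    |steklov r δ g x - g x| ≤ (2 ^ (2 * r) * δ ^ s) *
      (δ⁻¹ * ∫ u in (x - δ / 2)..(x + δ / 2), |iteratedDeriv s g u|) := by
  obtain ⟨k, rfl⟩ : ∃ k, s = k + 1 := ⟨s - 1, by omega⟩
  obtain ⟨j, hj⟩ : ∃ j, 2 * r = k + 1 + j := ⟨2 * r - (k + 1), by omega⟩
  have hr1 : (1:ℝ) ≤ r := by exact_mod_cast hr
  have hcont := (continuous_iterDeriv hg).abs
  rw [steklov_sub_smooth hr hg.continuous hδ]
  set I := ∫ u in (x - δ / 2)..(x + δ / 2), |iteratedDeriv (k + 1) g u| with hI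
  have hI0 : 0 ≤ I := intervalIntegral.integral_nonneg (by linarith) fun x _ => abs_nonneg _
  have hb : ∀ t ∈ Set.uIoc (0:ℝ) (δ / 2), ‖Delta (2 * r) (t / r) g (x - t)‖ ≤
      2 ^ (2 * r) * (δ ^ k * I) := by
    intro t ht
    rw [Set.uIoc_of_le (by linarith)] at ht
    have ht0 : 0 ≤ t / r := by have := ht.1; positivity
    have h1 := Delta_pointwise_ge k j ht0 hg (x - t)
    rw [← hj] at h1
    refine h1.trans ?_
    have e : x - t + ((2 * r : ℕ) : ℝ) * (t / r) = x + t := by push_cast; field_simp; ring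
    rw [e]
    have ht1 := ht.1
    have ht2 := ht.2
    have hIt0 : 0 ≤ ∫ u in (x - t)..(x + t), |iteratedDeriv (k + 1) g u| :=
      intervalIntegral.integral_nonneg (by linarith) fun x _ => abs_nonneg _
    gcongr
    · norm_num
    · omega
    · exact (div_le_self ht1.le hr1).trans (by linarith)
    · exact intervalIntegral.integral_mono_interval (by linarith) (by linarith) (by linarith)
        (Eventually.of_forall fun x => abs_nonneg _) (hcont.intervalIntegrable _ _)
  have h2 := intervalIntegral.norm_integral_le_of_norm_le_const hb
  rw [Real.norm_eq_abs, sub_zero, abs_of_pos (show 0 < δ / 2 by positivity)] at h2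
  have hC : (1:ℝ) ≤ ((2 * r).choose r : ℝ) := by
    have : 0 < (2 * r).choose r := Nat.choose_pos (by omega)
    exact_mod_cast this
  rw [abs_mul, abs_mul, abs_mul, abs_pow, abs_neg, abs_one, one_pow, one_mul, abs_inv,
    abs_of_pos (show (0:ℝ) < ((2 * r).choose r : ℝ) by linarith),
    abs_of_pos (show 0 < 2 / δ by positivity)]
  calc _ ≤ 1 * (2 / δ) * (2 ^ (2 * r) * (δ ^ k * I) * (δ / 2)) := by
        gcongr
        exact inv_le_one_of_one_le₀ hC
    _ = _ := by rw [pow_succ]; field_simp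

lemma steklov_intg {p : ℝ} (hp : 1 ≤ p) {f : ℝ → ℝ} (hf : MemLpT p f) (x : ℝ)
    {c : ℝ} (hc : c ≠ 0) (a b : ℝ) :
    IntervalIntegrable (fun t => f (x + c * t)) volume a b := by
  have h1 := (memLpT_intervalIntegrable hp (memLpT_translate hf x) (c * a) (c * b))
  have h2 := h1.comp_mul_left (c := c)
  rw [mul_div_cancel_left₀ _ hc, mul_div_cancel_left₀ _ hc] at h2
  simpa [add_comm] using h2

lemma steklov_coef {r ν : ℕ} (hν : ν ∈ Finset.range r) :
    0 < ((r : ℝ) - (ν : ℝ)) / (r : ℝ) ∧ ((r : ℝ) - (ν : ℝ)) / (r : ℝ) ≤ 1 ∧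
    1 ≤ r * (((r : ℝ) - (ν : ℝ)) / (r : ℝ)) := by
  have h := Finset.mem_range.1 hν
  have h1 : (ν:ℝ) + 1 ≤ r := by exact_mod_cast h
  have h0 : (0:ℝ) ≤ ν := by positivity
  have hr : (0:ℝ) < r := by linarith
  refine ⟨div_pos (by linarith) hr, (div_le_one hr).2 (by linarith), ?_⟩
  rw [mul_div_cancel₀ _ hr.ne']
  linarith

lemma steklov_sub {p : ℝ} (hp : 1 ≤ p) {r : ℕ} {f g : ℝ → ℝ} (hf : MemLpT p f) (hg : MemLpT p g)
    (δ x : ℝ) :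
    steklov r δ (fun x => f x - g x) x = steklov r δ f x - steklov r δ g x := by
  unfold steklov
  rw [← mul_sub, ← intervalIntegral.integral_sub]
  · congr 2
    funext t
    rw [← Finset.sum_sub_distrib]
    exact Finset.sum_congr rfl fun _ _ => by ring
  · have := IntervalIntegrable.sum (μ := volume) (a := -(δ/2)) (b := δ/2) (Finset.range r)
      (f := fun ν t => (-1 : ℝ) ^ ν * (((2 * r).choose ν : ℝ)) *
        f (x + (((r : ℝ) - (ν : ℝ)) / (r : ℝ)) * t))
      fun ν hν => (steklov_intg hp hf x (steklov_coef hν).1.ne' _ _).const_mul _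
    simpa [Finset.sum_fn] using this
  · have := IntervalIntegrable.sum (μ := volume) (a := -(δ/2)) (b := δ/2) (Finset.range r)
      (f := fun ν t => (-1 : ℝ) ^ ν * (((2 * r).choose ν : ℝ)) *
        g (x + (((r : ℝ) - (ν : ℝ)) / (r : ℝ)) * t))
      fun ν hν => (steklov_intg hp hg x (steklov_coef hν).1.ne' _ _).const_mul _
    simpa [Finset.sum_fn] using this

lemma steklov_bound {p : ℝ} (hp : 1 ≤ p) {r : ℕ} {f : ℝ → ℝ} (hf : MemLpT p f)
    {δ : ℝ} (hδ : 0 < δ) (x : ℝ) :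
    |steklov r δ f x| ≤ (2 * r ^ 2) * (δ⁻¹ * ∫ u in (x - δ / 2)..(x + δ / 2), |f u|) := by
  set I := ∫ u in (x - δ / 2)..(x + δ / 2), |f u| with hI
  have hI0 : 0 ≤ I := intervalIntegral.integral_nonneg (by linarith) fun x _ => abs_nonneg _
  have hC0 : (1:ℝ) ≤ ((2 * r).choose r : ℝ) := by
    have : 0 < (2 * r).choose r := Nat.choose_pos (by omega)
    exact_mod_cast this
  set C : ℝ := ((2 * r).choose r : ℝ) with hC
  unfold steklov
  rw [intervalIntegral.integral_finsetSum fun ν hν =>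
    (steklov_intg hp hf x (steklov_coef hν).1.ne' _ _).const_mul _]
  have hterm : ∀ ν ∈ Finset.range r,
      |∫ t in (-(δ/2))..(δ/2), (-1 : ℝ) ^ ν * (((2 * r).choose ν : ℝ)) *
        f (x + (((r : ℝ) - (ν : ℝ)) / (r : ℝ)) * t)| ≤ C * (r * I) := by
    intro ν hν
    obtain ⟨c0, c1, c2⟩ := steklov_coef hν
    set c := ((r : ℝ) - (ν : ℝ)) / (r : ℝ)
    rw [intervalIntegral.integral_const_mul, abs_mul, abs_mul, abs_pow, abs_neg, abs_one, one_pow,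
      one_mul, Nat.abs_cast, intervalIntegral.integral_comp_add_mul f c0.ne', smul_eq_mul, abs_mul,
      abs_of_pos (inv_pos.2 c0)]
    have hcd : c * (δ / 2) ≤ δ / 2 := mul_le_of_le_one_left (by linarith) c1
    have hcd0 : 0 < c * (δ / 2) := by positivity
    have h1 : |∫ u in (x + c * (-(δ/2)))..(x + c * (δ/2)), f u| ≤ I := by
      refine (intervalIntegral.abs_integral_le_integral_abs (by linarith)).trans ?_
      exact intervalIntegral.integral_mono_interval (by linarith) (by linarith) (by linarith)
        (Eventually.of_forall fun x => abs_nonneg _) (memLpT_intervalIntegrable hp hf _ _).abs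
    have h2 : c⁻¹ ≤ r := by
      rw [inv_le_iff_one_le_mul₀ c0]; exact c2
    have h3 : ((2 * r).choose ν : ℝ) ≤ C := by
      rw [hC]
      have := Nat.choose_le_centralBinom ν r
      rw [Nat.centralBinom] at this
      exact_mod_cast this
    gcongr
  have hsum : |∑ ν ∈ Finset.range r, ∫ t in (-(δ/2))..(δ/2),
      (-1 : ℝ) ^ ν * (((2 * r).choose ν : ℝ)) * f (x + (((r : ℝ) - (ν : ℝ)) / (r : ℝ)) * t)| ≤
      r * (C * (r * I)) := by
    refine (Finset.abs_sum_le_sum_abs _ _).trans ((Finset.sum_le_sum hterm).trans ?_)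
    simp
  rw [abs_mul, abs_mul, abs_mul, abs_pow, abs_neg, abs_one, one_pow, one_mul, abs_inv,
    abs_of_pos (show (0:ℝ) < C by linarith),
    abs_of_pos (show 0 < 2 / δ by positivity)]
  calc _ ≤ C⁻¹ * (2 / δ) * (r * (C * (r * I))) := by gcongr
    _ = _ := by field_simp

/-! ### Sampling operators -/

lemma memLpT_G {p : ℝ} (hp : 1 ≤ p) {X : ℕ → ℕ → ℝ} {φ : ℕ → ℕ → ℝ → ℝ}
    {G : ℕ → (ℝ → ℝ) → ℝ → ℝ} (hG : SamplingForm p X φ G) (n : ℕ) (f : ℝ → ℝ) :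
    MemLpT p (G n f) := by
  have e : G n f = fun x => ∑ k ∈ Finset.range n, f (X n k) * φ n k x := funext (hG.2 n f)
  rw [e]
  exact memLpT_sum hp _ fun i _ => memLpT_const_mul hp _ (hG.1 n i)

lemma memLpT_Gprev {p : ℝ} (hp : 1 ≤ p) {X : ℕ → ℕ → ℝ} {φ : ℕ → ℕ → ℝ → ℝ}
    {G : ℕ → (ℝ → ℝ) → ℝ → ℝ} (hG : SamplingForm p X φ G) (n : ℕ) (f : ℝ → ℝ) :
    MemLpT p (Gprev G f n) := by
  unfold Gprev
  split_ifs
  · exact memLpT_zero hp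
  · exact memLpT_G hp hG _ _

lemma G_sub {p : ℝ} {X : ℕ → ℕ → ℝ} {φ : ℕ → ℕ → ℝ → ℝ}
    {G : ℕ → (ℝ → ℝ) → ℝ → ℝ} (hG : SamplingForm p X φ G) (n : ℕ) (f g : ℝ → ℝ) (x : ℝ) :
    G n (fun x => f x - g x) x = G n f x - G n g x := by
  rw [hG.2, hG.2, hG.2, ← Finset.sum_sub_distrib]
  exact Finset.sum_congr rfl fun _ _ => by ring

lemma G_smooth {p K4 : ℝ} (hp : 1 ≤ p) (hK4 : 0 < K4) {s : ℕ} {X : ℕ → ℕ → ℝ} {φ : ℕ → ℕ → ℝ → ℝ}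
    {G : ℕ → (ℝ → ℝ) → ℝ → ℝ} (hG : SamplingForm p X φ G) {f : ℝ → ℝ} (hf : MemLpT p f)
    (h4 : CondC4 p K4 s G f) (m : ℕ) :
    SobolevW s (G (2 ^ m) f) ∧ LpNorm p (iteratedDeriv s (G (2 ^ m) f)) ≤
      K4 * ∑ k ∈ Finset.range (m + 1), (2 : ℝ) ^ (s * k) *
              (LpNorm p (fun x => f x - G (2 ^ k) f x) +
                LpNorm p (fun x => f x - Gprev G f k x)) := by
  have hd : ∀ k, LpNorm p (iteratedDeriv s (fun x => G (2 ^ k) f x - Gprev G f k x)) ≤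
      K4 * ((2 : ℝ) ^ (s * k) * (LpNorm p (fun x => f x - G (2 ^ k) f x) +
                LpNorm p (fun x => f x - Gprev G f k x))) := by
    intro k
    refine (h4 k).2.trans ?_
    rw [mul_assoc]
    gcongr
    have h := LpNorm_sub_le hp (memLpT_sub hp hf (memLpT_Gprev hp hG k f))
      (memLpT_sub hp hf (memLpT_G hp hG (2 ^ k) f))
    have e : (fun x => f x - Gprev G f k x - (f x - G (2 ^ k) f x)) =
      fun x => G (2 ^ k) f x - Gprev G f k x := by funext x; ring
    rw [e] at h
    linarith
  induction m with
  | zero =>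
    have e : (fun x => G (2 ^ 0) f x - Gprev G f 0 x) = G (2 ^ 0) f := by
      funext x; simp [Gprev]
    have h1 := (h4 0).1
    have h2 := hd 0
    rw [e] at h1 h2
    exact ⟨h1, by simpa using h2⟩
  | succ m ih =>
    obtain ⟨i1, i2⟩ := ih
    have hprev : Gprev G f (m + 1) = G (2 ^ m) f := by simp [Gprev]
    have h1 := (h4 (m + 1)).1
    have h2 := hd (m + 1)
    have e : G (2 ^ (m + 1)) f = (fun x => G (2 ^ (m + 1)) f x - Gprev G f (m + 1) x) +
        G (2 ^ m) f := by
      funext x; rw [hprev]; simp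
    have hS : SobolevW s (G (2 ^ (m + 1)) f) := by
      rw [e]; exact ⟨h1.1.add i1.1, h1.2.add i1.2⟩
    refine ⟨hS, ?_⟩
    have e2 : iteratedDeriv s (G (2 ^ (m + 1)) f) = fun x =>
        iteratedDeriv s (fun x => G (2 ^ (m + 1)) f x - Gprev G f (m + 1) x) x +
        iteratedDeriv s (G (2 ^ m) f) x := by
      funext x
      conv_lhs => rw [e]
      exact iteratedDeriv_add h1.2.contDiffAt i1.2.contDiffAt
    rw [e2, Finset.sum_range_succ, mul_add]
    refine (LpNorm_add_le hp (memLpT_iterDeriv hp h1) (memLpT_iterDeriv hp i1)).trans ?_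
    linarith

theorem stmt8 (p γ : ℝ) (r s : ℕ) (X : ℕ → ℕ → ℝ) (φ : ℕ → ℕ → ℝ → ℝ)
    (G : ℕ → (ℝ → ℝ) → ℝ → ℝ)
    (hp : 1 ≤ p) (hr : 1 ≤ r) (hs : 1 ≤ s) (hsr : s ≤ 2 * r)
    (hγ0 : 0 < γ) (hγ1 : γ ≤ 1) (hX : NodesOK γ X) (hGform : SamplingForm p X φ G)
    (K1 : ℝ) (hK1 : 0 < K1) (hc1 : CondC1 p K1 X G) (K2 : ℝ) (hK2 : 0 < K2) (hc1' : CondC1' p K2 X G) (K3 : ℝ) (hK3 : 0 < K3) (hc2' : CondC2' p K3 s G) (K4 : ℝ) (hK4 : 0 < K4) :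
    ∃ C : ℝ, 0 < C ∧ ∀ f : ℝ → ℝ, MemLpT p f → CondC4 p K4 s G f → ∀ n : ℕ, 1 ≤ n →
      ellp p n (X n) (fun x => steklov r (γ / (n : ℝ)) f x - f x) + omegaMod s p f (1 / (n : ℝ)) ≤
        C * (LpNorm p (fun x => f x - G n f x) +
          (1 / (n : ℝ) ^ s) * ∑ k ∈ Finset.range (Nat.log 2 n + 1),
            (2 : ℝ) ^ (s * k) *
              (LpNorm p (fun x => f x - G (2 ^ k) f x) +
                LpNorm p (fun x => f x - Gprev G f k x))) := by
  classical
  set A : ℝ := γ⁻¹ ^ (1 / p) with hA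
  have hA0 : 0 < A := by positivity
  set M : ℝ := (2 * r ^ 2) * A + K2⁻¹ + 2 ^ s with hM
  set N : ℝ := 2 ^ (2 * r) * A + K2⁻¹ * K3 + s with hN
  have hM0 : 0 < M := by positivity
  have hN0 : 0 < N := by positivity
  refine ⟨M * 2 ^ s + N * K4 + K2⁻¹, by positivity, ?_⟩
  intro f hf h4 n hn
  have hn0 : (0:ℝ) < n := by exact_mod_cast hn
  set m := Nat.log 2 n with hm
  set Sg := ∑ k ∈ Finset.range (m + 1), (2 : ℝ) ^ (s * k) *
              (LpNorm p (fun x => f x - G (2 ^ k) f x) +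
                LpNorm p (fun x => f x - Gprev G f k x)) with hSg
  obtain ⟨hgS, hgD⟩ := G_smooth hp hK4 hGform hf h4 m
  rw [← hSg] at hgD
  set E := LpNorm p (fun x => f x - G n f x) with hE
  have hE0 : 0 ≤ E := LpNorm_nonneg _ _
  have hfg : LpNorm p (fun x => f x - G (2 ^ m) f x) ≤ 2 ^ s * (1 / (n:ℝ) ^ s * Sg) := by
    have h1 : (2:ℝ) ^ (s * m) * LpNorm p (fun x => f x - G (2 ^ m) f x) ≤ Sg := by
      refine le_trans ?_ (Finset.single_le_sum (f := fun k => (2 : ℝ) ^ (s * k) *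
              (LpNorm p (fun x => f x - G (2 ^ k) f x) +
                LpNorm p (fun x => f x - Gprev G f k x))) (fun k _ => ?_)
                (Finset.mem_range.2 (Nat.lt_succ_self m)))
      · gcongr
        linarith [LpNorm_nonneg p (fun x => f x - Gprev G f m x)]
      · exact mul_nonneg (by positivity) (add_nonneg (LpNorm_nonneg _ _) (LpNorm_nonneg _ _))
    have h2 : (n:ℝ) ^ s ≤ 2 ^ s * 2 ^ (s * m) := by
      have h3 : (n:ℝ) ≤ 2 ^ (m + 1) := by
        have := Nat.lt_pow_succ_log_self (b := 2) (by norm_num) n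
        exact_mod_cast this.le
      calc (n:ℝ) ^ s ≤ (2 ^ (m + 1)) ^ s := by gcongr
        _ = _ := by rw [← pow_mul, ← pow_add]; congr 1; ring
    have h5 := LpNorm_nonneg p (fun x => f x - G (2 ^ m) f x)
    rw [one_div, mul_left_comm, ← div_eq_inv_mul, le_div_iff₀ (by positivity)]
    calc LpNorm p (fun x => f x - G (2 ^ m) f x) * (n:ℝ) ^ s
        ≤ LpNorm p (fun x => f x - G (2 ^ m) f x) * (2 ^ s * 2 ^ (s * m)) := by gcongr
      _ = 2 ^ s * (2 ^ (s * m) * LpNorm p (fun x => f x - G (2 ^ m) f x)) := by ring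
      _ ≤ _ := by gcongr
  set g := G (2 ^ m) f with hg
  have hgm : MemLpT p g := memLpT_G hp hGform _ _
  have hgfm := memLpT_sub hp hgm hf
  have hfgm := memLpT_sub hp hf hgm
  set e := LpNorm p (fun x => f x - g x) with he
  set d := LpNorm p (iteratedDeriv s g) with hd
  have hd0 : 0 ≤ d := LpNorm_nonneg _ _
  set δ := γ / (n:ℝ) with hδ
  have hδ0 : 0 < δ := by positivity
  have hδs : δ ^ s ≤ 1 / (n:ℝ) ^ s := by
    rw [hδ, div_pow]
    gcongr
    exact pow_le_one₀ hγ0.le hγ1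
  -- the three discrete terms
  have t1 : ellp p n (X n) (steklov r δ (fun x => f x - g x)) ≤ (2 * r ^ 2) * A * e :=
    ellp_local_le hp hγ0 hX hn hfgm (by positivity) fun x => steklov_bound hp hfgm hδ0 x
  have t2 : ellp p n (X n) (fun x => steklov r δ g x - g x) ≤
      2 ^ (2 * r) * A * (1 / (n:ℝ) ^ s * d) := by
    have := ellp_local_le (F := fun x => steklov r δ g x - g x) hp hγ0 hX hn
      (memLpT_iterDeriv hp hgS) (A := 2 ^ (2 * r) * δ ^ s) (by positivity)
      fun x => steklov_smooth_bound hr hs hsr hgS.2 hδ0 x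
    refine this.trans ?_
    calc 2 ^ (2 * r) * δ ^ s * A * d = 2 ^ (2 * r) * A * (δ ^ s * d) := by ring
      _ ≤ _ := by gcongr
  have t3 : ellp p n (X n) (fun x => g x - f x) ≤
      K2⁻¹ * (K3 * (1 / (n:ℝ) ^ s * d) + e + E) := by
    rw [← div_eq_inv_mul, le_div_iff₀ hK2, mul_comm]
    refine (hc1' _ hgfm n hn).trans ?_
    have q1 := hc2' g hgS n hn
    have hGnf := memLpT_G hp hGform n f
    have hGng := memLpT_G hp hGform n g
    have q2 := LpNorm_sub_le hp (memLpT_sub hp hf hGnf)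
      (memLpT_add hp (memLpT_sub hp hgm hGng) hfgm)
    have q3 := LpNorm_add_le hp (memLpT_sub hp hgm hGng) hfgm
    have q4 : (fun x => f x - G n f x - (g x - G n g x + (f x - g x))) =
        G n (fun x => g x - f x) := by
      funext x; rw [G_sub hGform]; ring
    rw [q4] at q2
    have q5 : K3 / (n:ℝ) ^ s * d = K3 * (1 / (n:ℝ) ^ s * d) := by ring
    linarith
  have t4 : omegaMod s p f (1 / (n:ℝ)) ≤ 2 ^ s * e + s * (1 / (n:ℝ) ^ s * d) := by
    refine (omegaMod_le hp hs hf hgS (by positivity)).trans (le_of_eq ?_)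
    rw [one_div_pow]; ring
  have t0 : ellp p n (X n) (fun x => steklov r δ f x - f x) ≤
      ellp p n (X n) (steklov r δ (fun x => f x - g x)) +
      (ellp p n (X n) (fun x => steklov r δ g x - g x) + ellp p n (X n) (fun x => g x - f x)) := by
    have a1 := ellp_add_le hp n (X n) (steklov r δ (fun x => f x - g x))
      (fun x => (steklov r δ g x - g x) + (g x - f x))
    have a2 := ellp_add_le hp n (X n) (fun x => steklov r δ g x - g x) (fun x => g x - f x)
    have a3 : (fun x => steklov r δ (fun x => f x - g x) x +
        ((steklov r δ g x - g x) + (g x - f x))) = fun x => steklov r δ f x - f x := by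
      funext x; rw [steklov_sub hp hf hgm]; ring
    rw [a3] at a1
    linarith
  have hT : 1 / (n:ℝ) ^ s * d ≤ K4 * (1 / (n:ℝ) ^ s * Sg) := by
    rw [mul_left_comm]
    gcongr
  have hT0 : 0 ≤ 1 / (n:ℝ) ^ s * Sg := by
    have h1 : 0 ≤ e := LpNorm_nonneg _ _
    have h2 : (0:ℝ) < 2 ^ s := by positivity
    exact (mul_nonneg_iff_of_pos_left h2).1 (h1.trans hfg)
  set T := 1 / (n:ℝ) ^ s * Sg with hTdef
  set D := 1 / (n:ℝ) ^ s * d with hDdef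
  have y1 : ellp p n (X n) (fun x => steklov r δ f x - f x) + omegaMod s p f (1 / (n:ℝ)) ≤
      M * e + N * D + K2⁻¹ * E := by
    rw [hM, hN]; linarith
  clear_value T D M N E e
  have y2 : M * e ≤ M * (2 ^ s * T) := mul_le_mul_of_nonneg_left hfg hM0.le
  have y3 : N * D ≤ N * (K4 * T) := mul_le_mul_of_nonneg_left hT hN0.le
  have z1 : 0 ≤ (M * 2 ^ s + N * K4) * E :=
    mul_nonneg (by positivity) hE0
  have z2 : 0 ≤ K2⁻¹ * T := mul_nonneg (inv_nonneg.2 hK2.le) hT0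
  have y4 : M * e + N * D + K2⁻¹ * E ≤ (M * 2 ^ s + N * K4 + K2⁻¹) * (E + T) := by linarith
  exact y1.trans y4
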